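/- There is no bijection f : {1,2,...,100} → {1,2,...,100} (i.e., no arrangement of the numbers 1 through 100 in a row) such that for every three consecutive positions i, i+1, i+2 the sum f(i) + f(i+1) + f(i+2) is a prime number. -/

import Mathlib

theorem no_arrangement_consecutive_triple_sums_prime :
    ¬ ∃ f : ℕ → ℕ, Set.BijOn f (Set.Ico 0 100) (Set.Icc 1 100) ∧
      ∀ i : ℕ, i ≤ 97 → Nat.Prime (f i + f (i + 1) + f (i + 2)) := by
  rintro ⟨f, hb, hp⟩
  -- every window sum exceeds 2, hence is odd
  have hpos : ∀ i, i < 100 → 1 ≤ f i := fun i hi => (hb.mapsTo ⟨Nat.zero_le i, hi⟩).1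
  have hodd : ∀ i, i ≤ 97 → (f i + f (i + 1) + f (i + 2)) % 2 = 1 := by
    intro i hi
    have h1 := hpos i (by omega)
    have h2 := hpos (i + 1) (by omega)
    have h3 := hpos (i + 2) (by omega)
    rcases (hp i hi).eq_two_or_odd with h | h <;> omega
  -- so parities have period 3
  have hper : ∀ i, i ≤ 96 → f (i + 3) % 2 = f i % 2 := by
    intro i hi
    have h1 := hodd i (by omega)
    have h2 := hodd (i + 1) (by omega)
    have e1 : i + 1 + 1 = i + 2 := rfl
    have e2 : i + 1 + 2 = i + 3 := rfl
    rw [e1, e2] at h2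
    omega
  -- the number of odd values is 50
  have hsum : ∑ i ∈ Finset.range 100, f i % 2 = ∑ j ∈ Finset.Icc 1 100, j % 2 := by
    apply Finset.sum_bij (fun i _ => f i)
    · intro i hi
      have := hb.mapsTo (⟨Nat.zero_le i, Finset.mem_range.1 hi⟩ : i ∈ Set.Ico 0 100)
      exact Finset.mem_Icc.2 this
    · intro i hi j hj h
      exact hb.injOn ⟨Nat.zero_le i, Finset.mem_range.1 hi⟩
        ⟨Nat.zero_le j, Finset.mem_range.1 hj⟩ h
    · intro j hj
      obtain ⟨i, hi, h⟩ := hb.surjOn (Finset.mem_Icc.1 hj : j ∈ Set.Icc 1 100)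
      exact ⟨i, Finset.mem_range.2 hi.2, h⟩
    · intro i _
      rfl
  have h50 : ∑ j ∈ Finset.Icc 1 100, j % 2 = 50 := by decide
  -- count by blocks of three
  have hblock : ∀ k, k ≤ 33 → f (3 * k) % 2 = f 0 % 2 ∧
      (∑ i ∈ Finset.range (3 * k), f i % 2) = k * (f 0 % 2 + f 1 % 2 + f 2 % 2) ∧
      (k ≤ 32 → f (3 * k + 1) % 2 = f 1 % 2 ∧ f (3 * k + 2) % 2 = f 2 % 2) := by
    intro k
    induction k with
    | zero => intro _; simp
    | succ k ih =>
      intro hk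
      obtain ⟨h0, hs, h12⟩ := ih (by omega)
      obtain ⟨h1, h2⟩ := h12 (by omega)
      have e : 3 * (k + 1) = 3 * k + 3 := by ring
      rw [e]
      refine ⟨by rw [hper _ (by omega), h0], ?_, fun hk' => ⟨?_, ?_⟩⟩
      · rw [Finset.sum_range_succ, Finset.sum_range_succ, Finset.sum_range_succ, hs, h0, h1, h2]
        ring
      · have := hper (3 * k + 1) (by omega)
        rw [← h1, ← this]
      · have := hper (3 * k + 2) (by omega)
        rw [← h2, ← this]
  obtain ⟨h0, hs, -⟩ := hblock 33 le_rfl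
  rw [Finset.sum_range_succ, h50] at hsum
  norm_num at h0 hs
  have := hodd 0 (by omega)
  norm_num at this
  omega
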